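/- arXiv:2210.11315 — 2 statements merged into one kernel-verified Lean document; each statement's English description precedes it below -/
import Mathlib

section
/- (Location part of Theorem 2b, via the reduced objective.) Let σ > 0, λ > 0 and κ ∈ (0,1) with κ ≥ (1 + λ·h(0))^{−1}. Then the function J(θ) = ∫_θ^1 e^{−λ g(t)} dt − κ·e^{−λ g(θ)}·(1−θ) on [0,1] attains its maximum at the unique θ* ∈ [0,1) satisfying λ·(1−θ*)·h(θ*) = κ^{−1} − 1, and this maximizer is unique. -/
/-- The standard normal cumulative distribution function
`Φ(x) = (1/√(2π)) ∫_{-∞}^x e^{-u²/2} du`. -/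
noncomputable def Phi (x : ℝ) : ℝ :=
  (Real.sqrt (2 * Real.pi))⁻¹ * ∫ u in Set.Iic x, Real.exp (-u ^ 2 / 2)

/-- The discount function `h(t) = 2Φ(σ(1-t)/2) - 1` for volatility `σ`. -/
noncomputable def h (σ t : ℝ) : ℝ := 2 * Phi (σ * (1 - t) / 2) - 1

/-- `g(t) = ∫₀ᵗ h(u) du`. -/
noncomputable def g (σ t : ℝ) : ℝ := ∫ u in (0:ℝ)..t, h σ u

/-- The explicit derivative of `h`: `h′(t) = -(σ/√(2π))·exp(-σ²(1-t)²/8)`. -/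
noncomputable def hDeriv (σ t : ℝ) : ℝ :=
  -(σ / Real.sqrt (2 * Real.pi)) * Real.exp (-(σ ^ 2 * (1 - t) ^ 2) / 8)

theorem aux_cont : Continuous (fun u : ℝ => Real.exp (-u ^ 2 / 2)) := by fun_prop

theorem aux_integrable : MeasureTheory.Integrable (fun u : ℝ => Real.exp (-u ^ 2 / 2)) := by
  have := integrable_exp_neg_mul_sq (b := 1 / 2) (by norm_num)
  refine this.congr (Filter.Eventually.of_forall fun x => ?_)
  simp only
  congr 1
  ring

theorem aux_Iic : ∫ u in Set.Iic (0:ℝ), Real.exp (-u ^ 2 / 2) = Real.sqrt (2 * Real.pi) / 2 := by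
  have h1 := integral_comp_neg_Iic (0:ℝ) (fun u : ℝ => Real.exp (-u ^ 2 / 2))
  simp only [neg_sq, neg_zero] at h1
  rw [h1]
  have h2 := integral_gaussian_Ioi (1 / 2)
  have h3 : Real.pi / (1 / 2) = 2 * Real.pi := by ring
  rw [h3] at h2
  rw [← h2]
  congr 1
  funext x
  congr 1
  ring

theorem aux_h (σ t : ℝ) : h σ t = 2 * (Real.sqrt (2 * Real.pi))⁻¹ *
    ∫ u in (0:ℝ)..(σ * (1 - t) / 2), Real.exp (-u ^ 2 / 2) := by
  have hs : 0 < Real.sqrt (2 * Real.pi) := Real.sqrt_pos.2 (by positivity)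
  rw [← intervalIntegral.integral_Iic_sub_Iic aux_integrable.integrableOn
    aux_integrable.integrableOn, aux_Iic, h, Phi]
  field_simp

theorem aux_hcont (σ : ℝ) : Continuous (h σ) := by
  have : h σ = fun t => 2 * (Real.sqrt (2 * Real.pi))⁻¹ *
    ∫ u in (0:ℝ)..(σ * (1 - t) / 2), Real.exp (-u ^ 2 / 2) := funext (aux_h σ)
  rw [this]
  refine continuous_const.mul ?_
  have hc := intervalIntegral.continuous_primitive
    (fun a b => aux_cont.intervalIntegrable (μ := MeasureTheory.volume) a b) 0
  exact hc.comp (by fun_prop : Continuous fun t : ℝ => σ * (1 - t) / 2)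

theorem aux_hanti (σ : ℝ) (hσ : 0 < σ) {a b : ℝ} (hab : a < b) : h σ b < h σ a := by
  have hs : 0 < Real.sqrt (2 * Real.pi) := Real.sqrt_pos.2 (by positivity)
  rw [aux_h, aux_h]
  refine mul_lt_mul_of_pos_left ?_ (by positivity)
  have hlt : σ * (1 - b) / 2 < σ * (1 - a) / 2 := by nlinarith
  have h1 := intervalIntegral.integral_interval_sub_left
    (aux_cont.intervalIntegrable (μ := MeasureTheory.volume) 0 (σ * (1 - a) / 2))
    (aux_cont.intervalIntegrable (μ := MeasureTheory.volume) 0 (σ * (1 - b) / 2))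
  have h2 : 0 < ∫ u in (σ * (1 - b) / 2)..(σ * (1 - a) / 2), Real.exp (-u ^ 2 / 2) :=
    intervalIntegral.intervalIntegral_pos_of_pos (aux_cont.intervalIntegrable _ _)
      (fun x => Real.exp_pos _) hlt
  linarith

theorem aux_h1 (σ : ℝ) : h σ 1 = 0 := by simp [aux_h]

theorem aux_g (σ t : ℝ) : HasDerivAt (g σ) (h σ t) t :=
  intervalIntegral.integral_hasDerivAt_right ((aux_hcont σ).intervalIntegrable _ _)
    ((aux_hcont σ).stronglyMeasurableAtFilter _ _) (aux_hcont σ).continuousAt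

theorem aux_J (σ lam κ : ℝ) (hκ : 0 < κ) (θ : ℝ) :
    HasDerivAt (fun θ => (∫ t in θ..(1:ℝ), Real.exp (-(lam * g σ t)))
          - κ * Real.exp (-(lam * g σ θ)) * (1 - θ))
      (κ * Real.exp (-(lam * g σ θ)) * (lam * (1 - θ) * h σ θ - (κ⁻¹ - 1))) θ := by
  have hgc : Continuous (g σ) := continuous_iff_continuousAt.2 fun t => (aux_g σ t).continuousAt
  have hec : Continuous (fun t => Real.exp (-(lam * g σ t))) := by fun_prop
  have h1 : HasDerivAt (fun θ => ∫ t in θ..(1:ℝ), Real.exp (-(lam * g σ t)))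
      (-Real.exp (-(lam * g σ θ))) θ :=
    intervalIntegral.integral_hasDerivAt_left (hec.intervalIntegrable _ _)
      (hec.stronglyMeasurableAtFilter _ _) hec.continuousAt
  have h2 := (((aux_g σ θ).const_mul lam).neg.exp.const_mul κ).mul ((hasDerivAt_id θ).const_sub 1)
  refine (h1.sub h2).congr_deriv ?_
  simp only [id, Pi.neg_apply]
  field_simp
  ring

/-- Location part of Theorem 2b: the reduced objective
`J(θ) = ∫_θ^1 e^{-λ g(t)} dt - κ e^{-λ g(θ)}(1-θ)` on `[0,1]` is maximized exactly at the
unique `θ* ∈ [0,1)` with `λ(1-θ*)h(θ*) = κ⁻¹ - 1`. -/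
theorem stmt_6 (σ lam κ : ℝ) (hσ : 0 < σ) (hlam : 0 < lam) (hκ : κ ∈ Set.Ioo (0:ℝ) 1)
    (hcond : (1 + lam * h σ 0)⁻¹ ≤ κ) :
    ∃ θs ∈ Set.Ico (0:ℝ) 1,
      lam * (1 - θs) * h σ θs = κ⁻¹ - 1 ∧
      (∀ θ ∈ Set.Ico (0:ℝ) 1, lam * (1 - θ) * h σ θ = κ⁻¹ - 1 → θ = θs) ∧
      IsMaxOn (fun θ => (∫ t in θ..(1:ℝ), Real.exp (-(lam * g σ t)))
          - κ * Real.exp (-(lam * g σ θ)) * (1 - θ)) (Set.Icc 0 1) θs ∧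
      (∀ θ ∈ Set.Icc (0:ℝ) 1,
        IsMaxOn (fun θ' => (∫ t in θ'..(1:ℝ), Real.exp (-(lam * g σ t)))
            - κ * Real.exp (-(lam * g σ θ')) * (1 - θ')) (Set.Icc 0 1) θ → θ = θs) := by
  obtain ⟨hκ0, hκ1⟩ := hκ
  set F : ℝ → ℝ := fun θ => lam * (1 - θ) * h σ θ with hF
  have hFc : Continuous F := by
    have := aux_hcont σ
    fun_prop
  have hFanti : ∀ a b : ℝ, a < b → b ≤ 1 → F b < F a := by
    intro a b hab hb
    have e1 := aux_hanti σ hσ hab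
    have e2 : 0 ≤ h σ b := by
      rcases hb.eq_or_lt with rfl | hb
      · rw [aux_h1]
      · have := aux_hanti σ hσ hb
        rw [aux_h1] at this
        exact this.le
    have e3 : lam * (1 - b) < lam * (1 - a) := mul_lt_mul_of_pos_left (by linarith) hlam
    have e4 : 0 ≤ lam * (1 - b) := mul_nonneg hlam.le (by linarith)
    simp only [hF]
    nlinarith
  have hc : 0 < κ⁻¹ - 1 := by
    have := (one_lt_inv₀ hκ0).2 hκ1
    linarith
  have hF1 : F 1 = 0 := by simp [hF]
  have hh0 : 0 < h σ 0 := by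
    have := aux_hanti σ hσ (zero_lt_one (α := ℝ))
    rwa [aux_h1] at this
  have hF0 : κ⁻¹ - 1 ≤ F 0 := by
    have hp : 0 < 1 + lam * h σ 0 := by positivity
    have := (inv_le_comm₀ hp hκ0).1 hcond
    simp only [hF]
    linarith
  obtain ⟨θs, ⟨hs0, hs1⟩, hs⟩ := intermediate_value_Icc' (zero_le_one (α := ℝ)) hFc.continuousOn
    (show κ⁻¹ - 1 ∈ Set.Icc (F 1) (F 0) from ⟨by rw [hF1]; exact hc.le, hF0⟩)
  have hs1' : θs < 1 := by
    rcases hs1.eq_or_lt with rfl | h'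
    · linarith
    · exact h'
  set J : ℝ → ℝ := fun θ => (∫ t in θ..(1:ℝ), Real.exp (-(lam * g σ t)))
          - κ * Real.exp (-(lam * g σ θ)) * (1 - θ) with hJ
  have hJd : ∀ θ, HasDerivAt J
      (κ * Real.exp (-(lam * g σ θ)) * (F θ - (κ⁻¹ - 1))) θ := aux_J σ lam κ hκ0
  have hJc : Continuous J := continuous_iff_continuousAt.2 fun t => (hJd t).continuousAt
  have hmono : StrictMonoOn J (Set.Icc 0 θs) := by
    refine strictMonoOn_of_deriv_pos (convex_Icc _ _) hJc.continuousOn fun x hx => ?_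
    rw [interior_Icc] at hx
    rw [(hJd x).deriv]
    have := hFanti x θs hx.2 hs1
    exact mul_pos (mul_pos hκ0 (Real.exp_pos _)) (by linarith)
  have hanti : StrictAntiOn J (Set.Icc θs 1) := by
    refine strictAntiOn_of_deriv_neg (convex_Icc _ _) hJc.continuousOn fun x hx => ?_
    rw [interior_Icc] at hx
    rw [(hJd x).deriv]
    have := hFanti θs x hx.1 hx.2.le
    exact mul_neg_of_pos_of_neg (mul_pos hκ0 (Real.exp_pos _)) (by linarith)
  have hlt : ∀ θ ∈ Set.Icc (0:ℝ) 1, θ ≠ θs → J θ < J θs := by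
    intro θ hθ hne
    rcases lt_or_gt_of_ne hne with h' | h'
    · exact hmono ⟨hθ.1, h'.le⟩ ⟨hs0, le_rfl⟩ h'
    · exact hanti ⟨le_rfl, hs1⟩ ⟨h'.le, hθ.2⟩ h'
  refine ⟨θs, ⟨hs0, hs1'⟩, hs, ?_, ?_, ?_⟩
  · intro θ hθ he
    have he' : F θ = κ⁻¹ - 1 := he
    rcases lt_trichotomy θ θs with h' | h' | h'
    · have := hFanti _ _ h' hs1
      linarith
    · exact h'
    · have := hFanti _ _ h' hθ.2.le
      linarith
  · intro θ hθ
    by_cases hne : θ = θs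
    · subst hne
      exact le_refl (J θ)
    · exact (hlt θ hθ hne).le
  · intro θ hθ hmax
    by_contra hne
    have h1 : J θs ≤ J θ := hmax ⟨hs0, hs1⟩
    exact absurd (hlt θ hθ hne) (not_lt.2 h1)
end

section
/- (Comparative statics in Theorem 2b.) Let σ > 0 and κ ∈ (0,1). Suppose θ : I → (0,1) is a differentiable function on an open interval I ⊆ (0,∞) satisfying λ·(1−θ(λ))·h(θ(λ)) = κ^{−1} − 1 for all λ ∈ I. Then for every λ ∈ I, θ′(λ) = (1−θ(λ))·h(θ(λ)) / (λ·[h(θ(λ)) − (1−θ(λ))·h′(θ(λ))]) > 0; that is, larger news-arrival rates produce longer initial sparing periods. -/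
theorem aux_Phi (x : ℝ) :
    HasDerivAt Phi ((Real.sqrt (2 * Real.pi))⁻¹ * Real.exp (-x ^ 2 / 2)) x := by
  have hint : MeasureTheory.Integrable (fun u : ℝ => Real.exp (-u ^ 2 / 2)) := by
    have := integrable_exp_neg_mul_sq (b := 1 / 2) (by norm_num)
    refine this.congr (Filter.Eventually.of_forall fun u => ?_)
    show Real.exp _ = Real.exp _
    congr 1
    ring
  have hc : Continuous (fun u : ℝ => Real.exp (-u ^ 2 / 2)) := by fun_prop
  have h1 : HasDerivAt (fun y : ℝ => ∫ u in (0:ℝ)..y, Real.exp (-u ^ 2 / 2))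
      (Real.exp (-x ^ 2 / 2)) x :=
    intervalIntegral.integral_hasDerivAt_right (hc.intervalIntegrable _ _)
      (hc.stronglyMeasurableAtFilter _ _) hc.continuousAt
  have h2 := (h1.const_add (∫ u in Set.Iic (0:ℝ), Real.exp (-u ^ 2 / 2))).const_mul
    (Real.sqrt (2 * Real.pi))⁻¹
  refine h2.congr_of_eventuallyEq (Filter.Eventually.of_forall fun y => ?_)
  have h3 := intervalIntegral.integral_Iic_sub_Iic (hint.integrableOn (s := Set.Iic (0:ℝ)))
    (hint.integrableOn (s := Set.Iic y))
  simp only [Phi]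
  rw [← h3]
  ring

theorem aux_h_s7 (σ t : ℝ) : HasDerivAt (h σ) (hDeriv σ t) t := by
  have h1 : HasDerivAt (fun t : ℝ => σ * (1 - t) / 2) (σ * (-1) / 2) t :=
    (((hasDerivAt_id t).const_sub 1).const_mul σ).div_const 2
  have h2 := (((aux_Phi (σ * (1 - t) / 2)).comp t h1).const_mul 2).sub_const 1
  refine h2.congr_deriv ?_
  have e : -(σ * (1 - t) / 2) ^ 2 / 2 = -(σ ^ 2 * (1 - t) ^ 2) / 8 := by ring
  rw [e, hDeriv]
  ring

/-- Comparative statics in Theorem 2b: if `θ(λ)` is differentiable on an open interval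
`I ⊆ (0,∞)` and satisfies `λ(1-θ(λ))h(θ(λ)) = κ⁻¹ - 1` there, then
`θ′(λ) = (1-θ)h(θ)/(λ[h(θ) - (1-θ)h′(θ)]) > 0`. -/
theorem stmt_7 (σ κ : ℝ) (hσ : 0 < σ) (hκ : κ ∈ Set.Ioo (0:ℝ) 1)
    (I : Set ℝ) (hIopen : IsOpen I) (hIconn : I.OrdConnected) (hIsub : I ⊆ Set.Ioi (0:ℝ))
    (θ θ' : ℝ → ℝ)
    (hrange : ∀ lam ∈ I, θ lam ∈ Set.Ioo (0:ℝ) 1)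
    (hderiv : ∀ lam ∈ I, HasDerivAt θ (θ' lam) lam)
    (heq : ∀ lam ∈ I, lam * (1 - θ lam) * h σ (θ lam) = κ⁻¹ - 1) :
    ∀ lam ∈ I,
      θ' lam = (1 - θ lam) * h σ (θ lam)
        / (lam * (h σ (θ lam) - (1 - θ lam) * hDeriv σ (θ lam))) ∧
      0 < θ' lam := by
  intro lam hl
  have hlam : 0 < lam := hIsub hl
  obtain ⟨-, ht1⟩ := hrange lam hl
  have hk : 0 < κ⁻¹ - 1 := sub_pos.2 ((one_lt_inv₀ hκ.1).2 hκ.2)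
  have he := heq lam hl
  have h1t : 0 < 1 - θ lam := by linarith
  have hh : 0 < h σ (θ lam) := by
    rw [← he] at hk
    exact (pos_iff_pos_of_mul_pos hk).1 (mul_pos hlam h1t)
  have hD : hDeriv σ (θ lam) < 0 := by
    have : 0 < (σ / Real.sqrt (2 * Real.pi)) *
      Real.exp (-(σ ^ 2 * (1 - θ lam) ^ 2) / 8) := by positivity
    rw [hDeriv]
    linarith
  have hden : 0 < lam * (h σ (θ lam) - (1 - θ lam) * hDeriv σ (θ lam)) :=
    mul_pos hlam (by nlinarith)
  have hd := hderiv lam hl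
  have d1 := ((hasDerivAt_id lam).mul (hd.const_sub 1)).mul ((aux_h_s7 σ (θ lam)).comp lam hd)
  have d2 : HasDerivAt (fun _ : ℝ => κ⁻¹ - 1) 0 lam := hasDerivAt_const _ _
  have d3 := d2.congr_of_eventuallyEq (f₁ := fun l => l * (1 - θ l) * h σ (θ l))
    (Filter.eventually_of_mem (hIopen.mem_nhds hl) heq)
  have key := d1.unique d3
  simp only [id, Function.comp, Pi.mul_apply] at key
  have hval : θ' lam = (1 - θ lam) * h σ (θ lam)
        / (lam * (h σ (θ lam) - (1 - θ lam) * hDeriv σ (θ lam))) := by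
    rw [eq_div_iff hden.ne']
    linarith
  exact ⟨hval, hval ▸ div_pos (mul_pos h1t hh) hden⟩
end
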